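/- Let N be a norm on ℝ² whose restriction to ℝ² \ {0} is of class C^{2,δ} for some δ ∈ (0,1), and assume the N-unit circle has strictly positive Euclidean curvature at every point. Then the family of projections Π : J × Ω → ℝ satisfies: (a) C^{1,δ}-regularity: for every compact interval I ⊂ J there is C_{I,δ} > 0 with |∂_t Π(t,x)| ≤ C_{I,δ} for all t ∈ I, x ∈ Ω, and |∂_t Π(t₁,x) − ∂_t Π(t₂,x)| ≤ C_{I,δ}|t₁ − t₂|^δ for all t₁, t₂ ∈ I, x ∈ Ω; (b) transversality: there exists C > 0 such that for all distinct x, y ∈ Ω and t ∈ J, |Φ_t(x,y)| ≤ C implies |d/dt Φ_t(x,y)| ≥ C; and (c) (1,δ)-regularity of Φ: there exist C̃ > 0 and C_δ > 0 such that whenever |Φ_{t₁}(x,y)| + |Φ_{t₂}(x,y)| ≤ C (with C as in (b)) for distinct x, y ∈ Ω and t₁, t₂ ∈ J, one has |d/dt Φ_{t₁}(x,y)| ≤ C̃ and |d/dt Φ_{t₁}(x,y) − d/dt Φ_{t₂}(x,y)| ≤ C_δ|t₁ − t₂|^δ. -/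

import Mathlib

open Set Metric Real
open scoped RealInnerProductSpace

noncomputable section

/-- The point `(a, b)` of the Euclidean plane. -/
def mk2 (a b : ℝ) : EuclideanSpace ℝ (Fin 2) :=
  (WithLp.equiv 2 (Fin 2 → ℝ)).symm ![a, b]

/-- The direction `v(t) = (cos t, sin t) ∈ S¹`. -/
def vdir (t : ℝ) : EuclideanSpace ℝ (Fin 2) :=
  mk2 (Real.cos t) (Real.sin t)

/-- `R v(t) = (−sin t, cos t)`, the rotation of `v(t)` by `π/2`. -/
def Rvdir (t : ℝ) : EuclideanSpace ℝ (Fin 2) :=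
  mk2 (-Real.sin t) (Real.cos t)

/-- The scalar projection family `Π(t,x) = ⟪P_{v(t)}(x), R v(t)⟫` associated with
a family `P` of closest-point projections. -/
def scalarProj (P : EuclideanSpace ℝ (Fin 2) → EuclideanSpace ℝ (Fin 2) → EuclideanSpace ℝ (Fin 2))
    (t : ℝ) (x : EuclideanSpace ℝ (Fin 2)) : ℝ :=
  ⟪P (vdir t) x, Rvdir t⟫

/-- `Φ_t(x,y) = (Π(t,x) − Π(t,y)) / N(x − y)`. -/
def projQuot (N : EuclideanSpace ℝ (Fin 2) → ℝ)
    (P : EuclideanSpace ℝ (Fin 2) → EuclideanSpace ℝ (Fin 2) → EuclideanSpace ℝ (Fin 2))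
    (t : ℝ) (x y : EuclideanSpace ℝ (Fin 2)) : ℝ :=
  (scalarProj P t x - scalarProj P t y) / N (x - y)

/-! ### Bounded Hölder functions -/

/-- `f` is bounded and `δ`-Hölder on `S`. -/
def BddHolderOn (δ : ℝ) (S : Set ℝ) (f : ℝ → ℝ) : Prop :=
  ∃ K, 0 ≤ K ∧ (∀ t ∈ S, |f t| ≤ K) ∧ ∀ s ∈ S, ∀ t ∈ S, |f s - f t| ≤ K * |s - t| ^ δ

namespace BddHolderOn

variable {δ : ℝ} {S : Set ℝ} {f g : ℝ → ℝ}

lemma of_bounds {K₁ K₂ : ℝ} (h₁ : ∀ t ∈ S, |f t| ≤ K₁)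
    (h₂ : ∀ s ∈ S, ∀ t ∈ S, |f s - f t| ≤ K₂ * |s - t| ^ δ) : BddHolderOn δ S f := by
  refine ⟨max 0 (max K₁ K₂), le_max_left _ _,
    fun t ht => (h₁ t ht).trans ((le_max_left _ _).trans (le_max_right _ _)),
    fun s hs t ht => (h₂ s hs t ht).trans ?_⟩
  gcongr
  exact (le_max_right _ _).trans (le_max_right _ _)

lemma const (c : ℝ) : BddHolderOn δ S fun _ => c :=
  of_bounds (K₁ := |c|) (K₂ := 0) (by simp) (by simp)

lemma neg (hf : BddHolderOn δ S f) : BddHolderOn δ S fun t => -f t := by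
  obtain ⟨K, hK, h₁, h₂⟩ := hf
  refine ⟨K, hK, fun t ht => by simpa using h₁ t ht, fun s hs t ht => ?_⟩
  rw [neg_sub_neg, abs_sub_comm]
  exact h₂ s hs t ht

lemma add (hf : BddHolderOn δ S f) (hg : BddHolderOn δ S g) :
    BddHolderOn δ S fun t => f t + g t := by
  obtain ⟨K, hK, h₁, h₂⟩ := hf
  obtain ⟨L, hL, k₁, k₂⟩ := hg
  refine ⟨K + L, by positivity,
    fun t ht => (abs_add_le _ _).trans (add_le_add (h₁ t ht) (k₁ t ht)), fun s hs t ht => ?_⟩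
  rw [add_sub_add_comm, add_mul]
  exact (abs_add_le _ _).trans (add_le_add (h₂ s hs t ht) (k₂ s hs t ht))

lemma mul (hf : BddHolderOn δ S f) (hg : BddHolderOn δ S g) :
    BddHolderOn δ S fun t => f t * g t := by
  obtain ⟨K, hK, h₁, h₂⟩ := hf
  obtain ⟨L, hL, k₁, k₂⟩ := hg
  refine of_bounds (K₁ := K * L) (K₂ := K * L + K * L) (fun t ht => ?_) fun s hs t ht => ?_
  · rw [abs_mul]
    exact mul_le_mul (h₁ t ht) (k₁ t ht) (abs_nonneg _) hK
  · calc |f s * g s - f t * g t| = |f s * (g s - g t) + (f s - f t) * g t| := by ring_nf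
      _ ≤ |f s| * |g s - g t| + |f s - f t| * |g t| := by
        rw [← abs_mul, ← abs_mul]; exact abs_add_le _ _
      _ ≤ K * (L * |s - t| ^ δ) + (K * |s - t| ^ δ) * L := by
        gcongr
        exacts [h₁ s hs, k₂ s hs t ht, h₂ s hs t ht, k₁ t ht]
      _ = _ := by ring

lemma inv {m : ℝ} (hf : BddHolderOn δ S f) (hm : 0 < m) (hfm : ∀ t ∈ S, m ≤ |f t|) :
    BddHolderOn δ S fun t => (f t)⁻¹ := by
  obtain ⟨K, hK, h₁, h₂⟩ := hf
  refine of_bounds (K₁ := m⁻¹) (K₂ := K / (m * m)) (fun t ht => ?_) fun s hs t ht => ?_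
  · rw [abs_inv]
    exact inv_anti₀ hm (hfm t ht)
  · have hs0 : f s ≠ 0 := abs_pos.1 (hm.trans_le (hfm s hs))
    have ht0 : f t ≠ 0 := abs_pos.1 (hm.trans_le (hfm t ht))
    rw [inv_sub_inv hs0 ht0, abs_div, abs_mul, abs_sub_comm, div_mul_eq_mul_div]
    exact div_le_div₀ (by positivity) (h₂ s hs t ht) (by positivity)
      (mul_le_mul (hfm s hs) (hfm t ht) hm.le (abs_nonneg _))

lemma congr (hf : BddHolderOn δ S f) (h : ∀ t ∈ S, g t = f t) : BddHolderOn δ S g := by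
  obtain ⟨K, hK, h₁, h₂⟩ := hf
  refine ⟨K, hK, fun t ht => h t ht ▸ h₁ t ht, fun s hs t ht => ?_⟩
  rw [h s hs, h t ht]
  exact h₂ s hs t ht

end BddHolderOn

lemma abs_sub_le_mul_rpow {a b δ : ℝ} (hδ1 : δ < 1) {s t : ℝ}
    (hs : s ∈ Icc a b) (ht : t ∈ Icc a b) :
    |s - t| ≤ (b - a) ^ (1 - δ) * |s - t| ^ δ := by
  rcases eq_or_ne s t with rfl | hst
  · simpa using mul_nonneg (rpow_nonneg (sub_nonneg.2 (hs.1.trans hs.2)) _)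
      (rpow_nonneg le_rfl _)
  · have hpos : 0 < |s - t| := abs_pos.2 (sub_ne_zero.2 hst)
    have hle : |s - t| ≤ b - a := abs_sub_le_of_le_of_le hs.1 hs.2 ht.1 ht.2
    calc |s - t| = |s - t| ^ (1 - δ) * |s - t| ^ δ := by
          rw [← rpow_add hpos]; simp
      _ ≤ _ := by
          gcongr

lemma exists_lipschitz_bound {F : Type*} [NormedAddCommGroup F] [NormedSpace ℝ F] {f : ℝ → F}
    (hf : ContDiff ℝ 1 f) (a b : ℝ) :
    ∃ K, 0 ≤ K ∧ ∀ s ∈ Icc a b, ∀ t ∈ Icc a b, ‖f s - f t‖ ≤ K * |s - t| := by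
  obtain ⟨K, hK⟩ := isCompact_Icc.exists_bound_of_continuousOn (s := Icc a b)
    (hf.continuous_deriv le_rfl).continuousOn
  refine ⟨max 0 K, le_max_left _ _, fun s hs t ht => ?_⟩
  exact (convex_Icc a b).norm_image_sub_le_of_norm_deriv_le
    (fun x _ => hf.differentiable one_ne_zero x)
    (fun x hx => (hK x hx).trans (le_max_right _ _)) ht hs

lemma ContDiff.bddHolderOn {f : ℝ → ℝ} (hf : ContDiff ℝ 1 f) {δ : ℝ} (hδ1 : δ < 1) (a b : ℝ) :
    BddHolderOn δ (Icc a b) f := by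
  obtain ⟨K, hK⟩ := isCompact_Icc.exists_bound_of_continuousOn (s := Icc a b)
    hf.continuous.continuousOn
  obtain ⟨L, hL, hL'⟩ := exists_lipschitz_bound hf a b
  refine BddHolderOn.of_bounds (K₁ := K) (K₂ := L * (b - a) ^ (1 - δ)) hK fun s hs t ht => ?_
  refine (hL' s hs t ht).trans ?_
  rw [mul_assoc]
  gcongr
  exact abs_sub_le_mul_rpow hδ1 hs ht

/-! ### Implicitly defined functions -/

lemma differentiableAt_of_unique_zero {F : ℝ × ℝ → ℝ} {c : ℝ → ℝ} {t d : ℝ}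
    (hF : ContDiffAt ℝ 1 F (t, c t)) (hc : ∀ t, F (t, c t) = 0)
    (huniq : ∀ t s, F (t, s) = 0 → s = c t)
    (hd : HasDerivAt (fun s => F (t, s)) d (c t)) (hd0 : d ≠ 0) : DifferentiableAt ℝ c t := by
  have hs : HasStrictFDerivAt F (fderiv ℝ F (t, c t)) (t, c t) :=
    hF.hasStrictFDerivAt one_ne_zero
  have hinr : HasDerivAt (fun s => F (t, s)) (fderiv ℝ F (t, c t) (0, 1)) (c t) :=
    hs.hasFDerivAt.comp_hasDerivAt (c t) ((hasDerivAt_const (c t) t).prodMk (hasDerivAt_id (c t)))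
  have hdd : fderiv ℝ F (t, c t) (0, 1) = d := hinr.unique hd
  have hinv : (fderiv ℝ F (t, c t) ∘L .inr ℝ ℝ ℝ).IsInvertible := by
    refine ⟨ContinuousLinearEquiv.unitsEquivAut ℝ (Units.mk0 d hd0), ?_⟩
    ext
    simp [hdd]
  refine (hs.hasStrictFDerivAt_implicitFunctionOfProdDomain
    hinv).hasFDerivAt.differentiableAt.congr_of_eventuallyEq ?_
  filter_upwards [hs.eventually_apply_implicitFunctionOfProdDomain hinv] with x hx
  exact (huniq x _ (hx.trans (hc t))).symm

/-! ### The Euclidean plane -/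

/-- The Euclidean plane. -/
abbrev Plane := EuclideanSpace ℝ (Fin 2)

lemma Plane.eq_combination (x : Plane) : x = x 0 • mk2 1 0 + x 1 • mk2 0 1 := by
  ext i
  fin_cases i <;> simp [mk2]

lemma exists_eq_smul_of_apply_eq_zero {ℓ : Plane →L[ℝ] ℝ} (hℓ : ℓ ≠ 0) {p w : Plane}
    (hw : w ≠ 0) (hpℓ : ℓ p = 0) (hwℓ : ℓ w = 0) : ∃ κ : ℝ, p = κ • w := by
  have key : ∀ x : Plane, ℓ x = x 0 * ℓ (mk2 1 0) + x 1 * ℓ (mk2 0 1) := fun x => by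
    conv_lhs => rw [x.eq_combination]
    simp
  rw [key] at hpℓ hwℓ
  have hne : ℓ (mk2 1 0) ≠ 0 ∨ ℓ (mk2 0 1) ≠ 0 := by
    by_contra! h
    exact hℓ (ContinuousLinearMap.ext fun x => by simp [key x, h.1, h.2])
  have hdet : p 0 * w 1 = p 1 * w 0 := by
    rcases hne with h | h
    · refine mul_left_cancel₀ h ?_
      linear_combination w 1 * hpℓ - p 1 * hwℓ
    · refine mul_left_cancel₀ h ?_
      linear_combination p 0 * hwℓ - w 0 * hpℓ
  by_cases h0 : w 0 = 0
  · have h1 : w 1 ≠ 0 := fun h1 => hw (by ext i; fin_cases i <;> simp [h0, h1])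
    refine ⟨p 1 / w 1, ?_⟩
    ext i
    fin_cases i
    · simpa [h0, h1] using hdet
    · simp [h1]
  · refine ⟨p 0 / w 0, ?_⟩
    ext i
    fin_cases i
    · simp [h0]
    · simp only [PiLp.smul_apply, smul_eq_mul, Fin.mk_one]
      field_simp
      linear_combination -hdet

lemma inner_vdir (x : Plane) (t : ℝ) : ⟪x, vdir t⟫ = x 0 * cos t + x 1 * sin t := by
  simp [vdir, mk2, PiLp.inner_apply, Fin.sum_univ_two, mul_comm]

lemma inner_Rvdir (x : Plane) (t : ℝ) : ⟪x, Rvdir t⟫ = -(x 0 * sin t) + x 1 * cos t := by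
  simp [Rvdir, mk2, PiLp.inner_apply, Fin.sum_univ_two, mul_comm]

lemma eq_vdir_add_Rvdir (x : Plane) (t : ℝ) :
    x = ⟪x, vdir t⟫ • vdir t + ⟪x, Rvdir t⟫ • Rvdir t := by
  have h := sin_sq_add_cos_sq t
  ext i
  rw [inner_vdir, inner_Rvdir]
  fin_cases i
  · simp [vdir, Rvdir, mk2]
    linear_combination -x 0 * h
  · simp [vdir, Rvdir, mk2]
    linear_combination -x 1 * h

lemma vdir_mem_sphere (t : ℝ) : vdir t ∈ sphere (0 : Plane) 1 := by
  rw [mem_sphere_zero_iff_norm, ← sq_eq_sq₀ (norm_nonneg _) zero_le_one,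
    ← real_inner_self_eq_norm_sq, inner_vdir]
  simp only [vdir, mk2, WithLp.equiv_symm_apply, Matrix.cons_val_zero, Matrix.cons_val_one]
  linear_combination sin_sq_add_cos_sq t

lemma inner_vdir_Rvdir (t : ℝ) : ⟪vdir t, Rvdir t⟫ = 0 := by
  rw [inner_Rvdir]
  simp [vdir, mk2]
  ring

lemma inner_vdir_self (t : ℝ) : ⟪vdir t, vdir t⟫ = 1 := by
  rw [real_inner_self_eq_norm_sq, mem_sphere_zero_iff_norm.1 (vdir_mem_sphere t), one_pow]

lemma vdir_add_smul_Rvdir_ne_zero (t s : ℝ) : vdir t + s • Rvdir t ≠ 0 := by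
  intro h
  have := congrArg (fun z => ⟪vdir t, z⟫) h
  rw [inner_add_right, inner_smul_right, inner_vdir_self, inner_vdir_Rvdir, inner_zero_right] at this
  simp at this

lemma Rvdir_ne_zero (t : ℝ) : Rvdir t ≠ 0 := by
  intro h
  have h0 := congrArg (fun z : Plane => z 0) h
  have h1 := congrArg (fun z : Plane => z 1) h
  simp [Rvdir, mk2] at h0 h1
  simpa [h0, h1] using sin_sq_add_cos_sq t

lemma vdir_eq (t : ℝ) : vdir t = cos t • mk2 1 0 + sin t • mk2 0 1 := by
  simpa [vdir, mk2] using Plane.eq_combination (vdir t)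

lemma Rvdir_eq (t : ℝ) : Rvdir t = -sin t • mk2 1 0 + cos t • mk2 0 1 := by
  simpa [Rvdir, mk2] using Plane.eq_combination (Rvdir t)

lemma contDiff_vdir {n : WithTop ℕ∞} : ContDiff ℝ n vdir := by
  have : vdir = fun t => cos t • mk2 1 0 + sin t • mk2 0 1 := funext vdir_eq
  rw [this]
  fun_prop

lemma contDiff_Rvdir {n : WithTop ℕ∞} : ContDiff ℝ n Rvdir := by
  have : Rvdir = fun t => -sin t • mk2 1 0 + cos t • mk2 0 1 := funext Rvdir_eq
  rw [this]
  fun_prop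

lemma hasDerivAt_vdir (t : ℝ) : HasDerivAt vdir (Rvdir t) t := by
  rw [funext vdir_eq, Rvdir_eq]
  exact ((hasDerivAt_cos t).smul_const _).add ((hasDerivAt_sin t).smul_const _)

lemma hasDerivAt_Rvdir (t : ℝ) : HasDerivAt Rvdir (-vdir t) t := by
  rw [funext Rvdir_eq, vdir_eq, neg_add, ← neg_smul, ← neg_smul]
  exact ((hasDerivAt_sin t).neg.smul_const _).add ((hasDerivAt_cos t).smul_const _)

/-! ### Norms on the plane of class `C²` away from the origin -/

/-- `N` is a norm on the plane. -/
structure IsPlaneNorm (N : Plane → ℝ) : Prop where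
  add_le : ∀ x y, N (x + y) ≤ N x + N y
  map_smul : ∀ (c : ℝ) x, N (c • x) = |c| * N x
  eq_zero : ∀ x, N x = 0 → x = 0

lemma hasDerivAt_comp_line {F : Type*} [NormedAddCommGroup F] [NormedSpace ℝ F] {f : Plane → F}
    (p q : Plane) (s : ℝ) (hf : DifferentiableAt ℝ f (p + s • q)) :
    HasDerivAt (fun s => f (p + s • q)) (fderiv ℝ f (p + s • q) q) s := by
  have h : HasDerivAt (fun s : ℝ => p + s • q) q s := by
    simpa using ((hasDerivAt_id s).smul_const q).const_add p
  exact hf.hasFDerivAt.comp_hasDerivAt s h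

namespace IsPlaneNorm

variable {N : Plane → ℝ}

lemma map_zero (hN : IsPlaneNorm N) : N 0 = 0 := by
  simpa using hN.map_smul 0 0

lemma nonneg (hN : IsPlaneNorm N) (x : Plane) : 0 ≤ N x := by
  have h := hN.add_le x ((-1 : ℝ) • x)
  rw [hN.map_smul] at h
  simp [hN.map_zero] at h
  linarith

lemma pos (hN : IsPlaneNorm N) {x : Plane} (hx : x ≠ 0) : 0 < N x :=
  (hN.nonneg x).lt_of_ne fun h => hx (hN.eq_zero x h.symm)

lemma exists_norm_le (hN : IsPlaneNorm N) (hc : ContinuousOn N {0}ᶜ) :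
    ∃ M, 0 < M ∧ ∀ x, ‖x‖ ≤ M * N x := by
  have hne : (sphere (0 : Plane) 1).Nonempty := ⟨_, vdir_mem_sphere 0⟩
  have hsub : sphere (0 : Plane) 1 ⊆ {0}ᶜ := fun x hx h0 => by
    rw [mem_singleton_iff.1 h0] at hx
    simp at hx
  obtain ⟨z, hz, hmin⟩ := (isCompact_sphere (0 : Plane) 1).exists_isMinOn hne (hc.mono hsub)
  have hz0 : 0 < N z := hN.pos (hsub hz)
  refine ⟨(N z)⁻¹, by positivity, fun x => ?_⟩
  rcases eq_or_ne x 0 with rfl | hx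
  · simp [hN.map_zero]
  · have hx' : 0 < ‖x‖ := norm_pos_iff.2 hx
    have := hmin (show ‖x‖⁻¹ • x ∈ sphere (0 : Plane) 1 by simp [norm_smul, hx])
    simp only [mem_ofPred_eq, hN.map_smul, abs_inv, abs_norm] at this
    rw [le_inv_mul_iff₀ hx'] at this
    rw [le_inv_mul_iff₀ hz0]
    linarith

lemma exists_le_norm (hN : IsPlaneNorm N) : ∃ M, 0 < M ∧ ∀ x, N x ≤ M * ‖x‖ := by
  refine ⟨N (mk2 1 0) + N (mk2 0 1) + 1,
    by linarith [hN.nonneg (mk2 1 0), hN.nonneg (mk2 0 1)], fun x => ?_⟩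
  have h := hN.add_le (x 0 • mk2 1 0) (x 1 • mk2 0 1)
  rw [← x.eq_combination, hN.map_smul, hN.map_smul] at h
  have h0 := mul_le_mul_of_nonneg_right (PiLp.norm_apply_le x 0) (hN.nonneg (mk2 1 0))
  have h1 := mul_le_mul_of_nonneg_right (PiLp.norm_apply_le x 1) (hN.nonneg (mk2 0 1))
  rw [Real.norm_eq_abs] at h0 h1
  linarith [norm_nonneg x]

lemma convexOn_line (hN : IsPlaneNorm N) (p q : Plane) :
    ConvexOn ℝ univ fun s : ℝ => N (p + s • q) := by
  refine ⟨convex_univ, fun x _ y _ a b ha hb hab => ?_⟩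
  have : p + (a • x + b • y) • q = a • (p + x • q) + b • (p + y • q) := by
    have hp : p = a • p + b • p := by rw [← add_smul, hab, one_smul]
    conv_lhs => rw [hp]
    simp only [smul_eq_mul]
    module
  simp only [this]
  refine (hN.add_le _ _).trans_eq ?_
  rw [hN.map_smul, hN.map_smul, abs_of_nonneg ha, abs_of_nonneg hb, smul_eq_mul, smul_eq_mul]

lemma fderiv_smul (hN : IsPlaneNorm N) {s : ℝ} (hs : 0 < s) (x : Plane) :
    fderiv ℝ N (s • x) = fderiv ℝ N x := by
  have h1 : fderiv ℝ (fun y => N (s • y)) x = s • fderiv ℝ N (s • x) := fderiv_comp_smul s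
  have h2 : (fun y => N (s • y)) = s • N := funext fun y => by
    simp [hN.map_smul, abs_of_pos hs]
  rw [h2, fderiv_const_smul_field] at h1
  exact (smul_right_injective _ hs.ne' h1).symm

end IsPlaneNorm

section Smooth

variable {N : Plane → ℝ}

lemma contDiffAt_of_ne_zero (hC : ContDiffOn ℝ 2 N {0}ᶜ) {x : Plane} (hx : x ≠ 0) :
    ContDiffAt ℝ 2 N x :=
  hC.contDiffAt (isOpen_compl_singleton.mem_nhds hx)

lemma contDiffAt_fderiv (hC : ContDiffOn ℝ 2 N {0}ᶜ) {x : Plane} (hx : x ≠ 0) :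
    ContDiffAt ℝ 1 (fderiv ℝ N) x :=
  (contDiffAt_of_ne_zero hC hx).fderiv_right (by norm_num)

lemma continuousAt_fderiv_fderiv (hC : ContDiffOn ℝ 2 N {0}ᶜ) {x : Plane} (hx : x ≠ 0) :
    ContinuousAt (fderiv ℝ (fderiv ℝ N)) x :=
  ((contDiffAt_fderiv hC hx).fderiv_right (m := 0) (by norm_num)).continuousAt

lemma differentiableAt_of_ne_zero (hC : ContDiffOn ℝ 2 N {0}ᶜ) {x : Plane} (hx : x ≠ 0) :
    DifferentiableAt ℝ N x :=
  (contDiffAt_of_ne_zero hC hx).differentiableAt two_ne_zero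

lemma differentiableAt_fderiv (hC : ContDiffOn ℝ 2 N {0}ᶜ) {x : Plane} (hx : x ≠ 0) :
    DifferentiableAt ℝ (fderiv ℝ N) x :=
  (contDiffAt_fderiv hC hx).differentiableAt one_ne_zero

lemma fderiv_apply_self (hN : IsPlaneNorm N) (hC : ContDiffOn ℝ 2 N {0}ᶜ) {x : Plane}
    (hx : x ≠ 0) : fderiv ℝ N x x = N x := by
  have h1 := hasDerivAt_comp_line (f := N) 0 x 1
    (by simpa using differentiableAt_of_ne_zero hC hx)
  have h2 : HasDerivAt (fun s : ℝ => s * N x) (N x) 1 := by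
    simpa using (hasDerivAt_id (1 : ℝ)).mul_const (N x)
  have h3 : (fun s : ℝ => N (0 + s • x)) =ᶠ[nhds 1] fun s => s * N x := by
    filter_upwards [lt_mem_nhds (zero_lt_one' ℝ)] with s hs
    rw [zero_add, hN.map_smul, abs_of_pos hs]
  simpa using h1.unique (h2.congr_of_eventuallyEq h3)

lemma fderiv_fderiv_apply_self (hN : IsPlaneNorm N) (hC : ContDiffOn ℝ 2 N {0}ᶜ) {x : Plane}
    (hx : x ≠ 0) : fderiv ℝ (fderiv ℝ N) x x = 0 := by
  have h1 := hasDerivAt_comp_line (f := fderiv ℝ N) 0 x 1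
    (by simpa using differentiableAt_fderiv hC hx)
  have h3 : (fun s : ℝ => fderiv ℝ N (0 + s • x)) =ᶠ[nhds 1] fun _ => fderiv ℝ N x := by
    filter_upwards [lt_mem_nhds (zero_lt_one' ℝ)] with s hs
    rw [zero_add, hN.fderiv_smul hs]
  simpa using h1.unique ((hasDerivAt_const (1 : ℝ) _).congr_of_eventuallyEq h3)

/-- The Hessian of a norm whose unit circle has nonvanishing curvature is nondegenerate in
tangential directions. -/
lemma fderiv_fderiv_apply_ne_zero (hN : IsPlaneNorm N) (hC : ContDiffOn ℝ 2 N {0}ᶜ)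
    {γ : ℝ → Plane} (hγ_C2 : ContDiff ℝ 2 γ)
    (hγ_range : Set.range γ = {x : Plane | N x = 1}) (hγ_unit : ∀ t, ‖deriv γ t‖ = 1)
    (hγ_curv : ∀ t, deriv (deriv γ) t ≠ 0) {x w : Plane} (hx : x ≠ 0) (hw : w ≠ 0)
    (hxw : fderiv ℝ N x w = 0) : fderiv ℝ (fderiv ℝ N) x w w ≠ 0 := by
  intro hzero
  have hNx := hN.pos hx
  have hγN : ∀ t, N (γ t) = 1 := fun t => hγ_range.subset (mem_range_self t)
  have hγ0 : ∀ t, γ t ≠ 0 := fun t h => by simpa [h, hN.map_zero] using hγN t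
  obtain ⟨τ, hτ⟩ : (N x)⁻¹ • x ∈ Set.range γ := by
    rw [hγ_range, mem_ofPred_eq, hN.map_smul, abs_inv, abs_of_pos hNx, inv_mul_cancel₀ hNx.ne']
  have hxτ : N x • γ τ = x := by rw [hτ, smul_inv_smul₀ hNx.ne']
  have hd1 : ∀ t, HasDerivAt γ (deriv γ t) t := fun t =>
    (hγ_C2.differentiable two_ne_zero t).hasDerivAt
  have hd2 : HasDerivAt (deriv γ) (deriv (deriv γ) τ) τ :=
    ((contDiff_succ_iff_deriv.1 (show ContDiff ℝ (1 + 1) γ by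
      norm_num; exact hγ_C2)).2.2.differentiable one_ne_zero τ).hasDerivAt
  have htan : ∀ t, fderiv ℝ N (N x • γ t) (deriv γ t) = 0 := fun t => by
    rw [hN.fderiv_smul hNx]
    have h1 : HasDerivAt (fun t => N (γ t)) _ t :=
      (differentiableAt_of_ne_zero hC (hγ0 t)).hasFDerivAt.comp_hasDerivAt t (hd1 t)
    simp only [hγN] at h1
    exact h1.unique (hasDerivAt_const t 1)
  have hDτ := htan τ
  rw [hxτ] at hDτ
  have hDx : fderiv ℝ N x ≠ 0 := fun h => by
    have := fderiv_apply_self hN hC hx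
    simp [h] at this
    exact hNx.ne this
  obtain ⟨κ, hκ⟩ := exists_eq_smul_of_apply_eq_zero hDx hw hDτ hxw
  have hsecond : fderiv ℝ (fderiv ℝ N) x (N x • deriv γ τ) (deriv γ τ)
      + fderiv ℝ N x (deriv (deriv γ) τ) = 0 := by
    have hA : HasDerivAt (fun t => fderiv ℝ N (N x • γ t))
        (fderiv ℝ (fderiv ℝ N) (N x • γ τ) (N x • deriv γ τ)) τ :=
      (differentiableAt_fderiv hC (by rwa [hxτ])).hasFDerivAt.comp_hasDerivAt τ
        ((hd1 τ).const_smul (N x))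
    have hB := hA.clm_apply hd2
    simp only [htan, hxτ] at hB
    exact hB.unique (hasDerivAt_const τ 0)
  have hcurv : fderiv ℝ N x (deriv (deriv γ) τ) = 0 := by
    rw [hκ] at hsecond
    simpa [hzero] using hsecond
  have hγ'0 : deriv γ τ ≠ 0 := fun h => by simpa [h] using hγ_unit τ
  obtain ⟨μ, hμ⟩ := exists_eq_smul_of_apply_eq_zero hDx hγ'0 hcurv hDτ
  have horth : ⟪deriv γ τ, deriv (deriv γ) τ⟫ = 0 := by
    have h1 := hd2.inner ℝ hd2
    have h2 : (fun t => ⟪deriv γ t, deriv γ t⟫) = fun _ => (1 : ℝ) := funext fun t => by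
      rw [real_inner_self_eq_norm_sq, hγ_unit, one_pow]
    rw [h2] at h1
    have h3 := h1.unique (hasDerivAt_const τ 1)
    have h4 := real_inner_comm (deriv γ τ) (deriv (deriv γ) τ)
    linarith
  rw [hμ, inner_smul_right, real_inner_self_eq_norm_sq, hγ_unit, one_pow, mul_one] at horth
  exact hγ_curv τ (by rw [hμ, horth, zero_smul])

/-- A norm with nondegenerate Hessian has at most one critical point along a line that avoids
the origin. -/
lemma critical_point_unique (hN : IsPlaneNorm N) (hC : ContDiffOn ℝ 2 N {0}ᶜ) {p q : Plane}
    (hpq : ∀ s : ℝ, p + s • q ≠ 0)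
    (hH : ∀ s : ℝ, fderiv ℝ N (p + s • q) q = 0 → fderiv ℝ (fderiv ℝ N) (p + s • q) q q ≠ 0)
    {s₁ s₂ : ℝ} (h₁ : fderiv ℝ N (p + s₁ • q) q = 0) (h₂ : fderiv ℝ N (p + s₂ • q) q = 0) :
    s₁ = s₂ := by
  wlog hlt : s₁ < s₂ generalizing s₁ s₂
  · rcases (not_lt.1 hlt).eq_or_lt with h | h
    · exact h.symm
    · exact (this h₂ h₁ h).symm
  exfalso
  have hg : ∀ s, HasDerivAt (fun s : ℝ => N (p + s • q)) (fderiv ℝ N (p + s • q) q) s := fun s =>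
    hasDerivAt_comp_line p q s (differentiableAt_of_ne_zero hC (hpq s))
  have hmono := (hN.convexOn_line p q).monotoneOn_deriv fun s _ => (hg s).differentiableAt
  have hmono' : ∀ s t : ℝ, s ≤ t → fderiv ℝ N (p + s • q) q ≤ fderiv ℝ N (p + t • q) q := by
    intro s t hst
    rw [← (hg s).deriv, ← (hg t).deriv]
    exact hmono (mem_univ _) (mem_univ _) hst
  have hz : ∀ s ∈ Ioo s₁ s₂, fderiv ℝ N (p + s • q) q = 0 := fun s hs =>
    le_antisymm ((hmono' _ _ hs.2.le).trans_eq h₂) (h₁.ge.trans (hmono' _ _ hs.1.le))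
  obtain ⟨m, hm⟩ := nonempty_Ioo.2 hlt
  have hd := (hasDerivAt_comp_line p q m (differentiableAt_fderiv hC (hpq m))).clm_apply
    (hasDerivAt_const m q)
  have hev : (fun s : ℝ => fderiv ℝ N (p + s • q) q) =ᶠ[nhds m] fun _ => 0 := by
    filter_upwards [Ioo_mem_nhds hm.1 hm.2] with s hs using hz s hs
  refine hH m (hz m hm) ?_
  simpa using hd.unique ((hasDerivAt_const m (0 : ℝ)).congr_of_eventuallyEq hev)

lemma bddHolderOn_fderiv_fderiv (hC : ContDiffOn ℝ 2 N {0}ᶜ) {δ : ℝ} (hδ0 : 0 < δ)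
    (hN_holder : ∀ K : Set Plane, K ⊆ {0}ᶜ → IsCompact K → ∃ M : ℝ, ∀ x ∈ K, ∀ y ∈ K,
      ‖iteratedFDerivWithin ℝ 2 N ({0}ᶜ : Set Plane) x -
        iteratedFDerivWithin ℝ 2 N ({0}ᶜ : Set Plane) y‖ ≤ M * ‖x - y‖ ^ δ)
    {e : ℝ → Plane} (he : ContDiff ℝ 1 e) (he0 : ∀ t, e t ≠ 0) (a b : ℝ) (p q : Plane) :
    BddHolderOn δ (Icc a b) fun t => fderiv ℝ (fderiv ℝ N) (e t) p q := by
  have hcont : Continuous fun t => fderiv ℝ (fderiv ℝ N) (e t) p q := by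
    have : Continuous fun t => fderiv ℝ (fderiv ℝ N) (e t) :=
      continuous_iff_continuousAt.2 fun t =>
        ContinuousAt.comp (continuousAt_fderiv_fderiv hC (he0 t)) he.continuous.continuousAt
    fun_prop
  obtain ⟨B, hB⟩ := isCompact_Icc.exists_bound_of_continuousOn (s := Icc a b) hcont.continuousOn
  obtain ⟨L, hL, hL'⟩ := exists_lipschitz_bound he a b
  obtain ⟨M, hM⟩ := hN_holder (e '' Icc a b) (by rintro _ ⟨t, -, rfl⟩; exact he0 t)
    (isCompact_Icc.image he.continuous)
  refine BddHolderOn.of_bounds (K₁ := B) (K₂ := |M| * L ^ δ * (‖p‖ * ‖q‖)) hB fun s hs t ht => ?_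
  have happ : ∀ t, fderiv ℝ (fderiv ℝ N) (e t) p q =
      iteratedFDerivWithin ℝ 2 N ({0}ᶜ : Set Plane) (e t) ![p, q] := fun t => by
    rw [iteratedFDerivWithin_of_isOpen 2 isOpen_compl_singleton (he0 t), iteratedFDeriv_two_apply]
    simp
  rw [happ, happ, ← sub_apply, ← Real.norm_eq_abs]
  refine (ContinuousMultilinearMap.le_opNorm _ _).trans ?_
  have hprod : ∏ i : Fin 2, ‖(![p, q] : Fin 2 → Plane) i‖ = ‖p‖ * ‖q‖ := by
    simp [Fin.prod_univ_two]
  rw [hprod]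
  calc _ ≤ (|M| * (L * |s - t|) ^ δ) * (‖p‖ * ‖q‖) := by
        gcongr
        refine (hM _ (mem_image_of_mem e hs) _ (mem_image_of_mem e ht)).trans ?_
        gcongr
        exacts [le_abs_self M, hL' s hs t ht]
    _ = _ := by
        rw [mul_rpow hL (abs_nonneg _)]
        ring

end Smooth

/-! ### The slope function of the closest-point projections -/

lemma exists_slope {N : Plane → ℝ} (hN : IsPlaneNorm N) (hC : ContDiffOn ℝ 2 N {0}ᶜ)
    (hH : ∀ x w : Plane, x ≠ 0 → w ≠ 0 → fderiv ℝ N x w = 0 → fderiv ℝ (fderiv ℝ N) x w w ≠ 0)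
    {P : Plane → Plane → Plane}
    (hP : ∀ v ∈ sphere (0 : Plane) 1, ∀ x : Plane,
      ⟪v, P v x⟫ = 0 ∧ ∀ q : Plane, ⟪v, q⟫ = 0 → N (x - P v x) ≤ N (x - q)) :
    ∃ c : ℝ → ℝ, (∀ t, fderiv ℝ N (vdir t + c t • Rvdir t) (Rvdir t) = 0) ∧
      (∀ t s, fderiv ℝ N (vdir t + s • Rvdir t) (Rvdir t) = 0 → s = c t) ∧
      ∀ t x, scalarProj P t x = ⟪x, Rvdir t⟫ - ⟪x, vdir t⟫ * c t := by
  have hproj : ∀ t x, P (vdir t) x = scalarProj P t x • Rvdir t := fun t x => by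
    have h := eq_vdir_add_Rvdir (P (vdir t) x) t
    rwa [real_inner_comm, (hP _ (vdir_mem_sphere t) x).1, zero_smul, zero_add] at h
  have hcrit : ∀ t x, ⟪x, vdir t⟫ ≠ 0 → fderiv ℝ N
      (vdir t + ((⟪x, Rvdir t⟫ - scalarProj P t x) / ⟪x, vdir t⟫) • Rvdir t) (Rvdir t) = 0 := by
    intro t x hα
    set α := ⟪x, vdir t⟫ with hα_def
    set β := ⟪x, Rvdir t⟫ with hβ_def
    set s₀ := (β - scalarProj P t x) / α with hs₀
    have hline : ∀ s, x - (β - α * s) • Rvdir t = α • (vdir t + s • Rvdir t) := fun s => by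
      conv_lhs => rw [eq_vdir_add_Rvdir x t]
      rw [← hα_def, ← hβ_def]
      module
    have hs₀' : β - α * s₀ = scalarProj P t x := by
      rw [hs₀]
      field_simp
      ring
    have hmin : ∀ s, N (vdir t + s₀ • Rvdir t) ≤ N (vdir t + s • Rvdir t) := fun s => by
      have h := (hP _ (vdir_mem_sphere t) x).2 ((β - α * s) • Rvdir t)
        (by rw [inner_smul_right, inner_vdir_Rvdir, mul_zero])
      rw [hproj, ← hs₀', hline, hline, hN.map_smul, hN.map_smul] at h
      exact le_of_mul_le_mul_left h (abs_pos.2 hα)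
    exact IsLocalMin.hasDerivAt_eq_zero (Filter.Eventually.of_forall hmin)
      (hasDerivAt_comp_line _ _ _
        (differentiableAt_of_ne_zero hC (vdir_add_smul_Rvdir_ne_zero t s₀)))
  have huniq : ∀ t s₁ s₂, fderiv ℝ N (vdir t + s₁ • Rvdir t) (Rvdir t) = 0 →
      fderiv ℝ N (vdir t + s₂ • Rvdir t) (Rvdir t) = 0 → s₁ = s₂ := fun t s₁ s₂ =>
    critical_point_unique hN hC (vdir_add_smul_Rvdir_ne_zero t)
      fun s => hH _ _ (vdir_add_smul_Rvdir_ne_zero t s) (Rvdir_ne_zero t)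
  have hc : ∀ t, fderiv ℝ N (vdir t + (-scalarProj P t (vdir t)) • Rvdir t) (Rvdir t) = 0 := by
    intro t
    have h := hcrit t (vdir t) (by rw [inner_vdir_self]; exact one_ne_zero)
    rwa [inner_vdir_self, inner_vdir_Rvdir, zero_sub, div_one] at h
  refine ⟨fun t => -scalarProj P t (vdir t), hc, fun t s h => huniq t _ _ h (hc t),
    fun t x => ?_⟩
  by_cases hα : ⟪x, vdir t⟫ = 0
  · have hx : ⟪vdir t, x⟫ = 0 := by rw [real_inner_comm, hα]
    have h := (hP _ (vdir_mem_sphere t) x).2 x hx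
    rw [sub_self, hN.map_zero] at h
    have hPx : P (vdir t) x = x := (sub_eq_zero.1 (hN.eq_zero _ (h.antisymm (hN.nonneg _)))).symm
    rw [hα, zero_mul, sub_zero, scalarProj, hPx]
  · have h := huniq t _ _ (hcrit t x hα) (hc t)
    rw [div_eq_iff hα] at h
    linarith

section Slope

variable {N : Plane → ℝ} {c : ℝ → ℝ}

lemma differentiable_slope (hC : ContDiffOn ℝ 2 N {0}ᶜ)
    (hH : ∀ x w : Plane, x ≠ 0 → w ≠ 0 → fderiv ℝ N x w = 0 → fderiv ℝ (fderiv ℝ N) x w w ≠ 0)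
    (hc : ∀ t, fderiv ℝ N (vdir t + c t • Rvdir t) (Rvdir t) = 0)
    (huniq : ∀ t s, fderiv ℝ N (vdir t + s • Rvdir t) (Rvdir t) = 0 → s = c t) :
    Differentiable ℝ c := by
  intro t
  refine differentiableAt_of_unique_zero
    (F := fun z => fderiv ℝ N (vdir z.1 + z.2 • Rvdir z.1) (Rvdir z.1)) ?_ hc huniq
    (d := fderiv ℝ (fderiv ℝ N) (vdir t + c t • Rvdir t) (Rvdir t) (Rvdir t)) ?_
    (hH _ _ (vdir_add_smul_Rvdir_ne_zero t _) (Rvdir_ne_zero t) (hc t))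
  · have hv : ContDiff ℝ 1 fun z : ℝ × ℝ => vdir z.1 := contDiff_vdir.comp contDiff_fst
    have hw : ContDiff ℝ 1 fun z : ℝ × ℝ => Rvdir z.1 := contDiff_Rvdir.comp contDiff_fst
    have hD : ContDiffAt ℝ 1 (fun z : ℝ × ℝ => fderiv ℝ N (vdir z.1 + z.2 • Rvdir z.1))
        (t, c t) :=
      ContDiffAt.comp (t, c t) (g := fderiv ℝ N)
        (contDiffAt_fderiv hC (vdir_add_smul_Rvdir_ne_zero t _))
        (hv.add (contDiff_snd.smul hw)).contDiffAt
    exact hD.clm_apply hw.contDiffAt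
  · simpa using (hasDerivAt_comp_line (vdir t) (Rvdir t) (c t) (differentiableAt_fderiv hC
      (vdir_add_smul_Rvdir_ne_zero t _))).clm_apply (hasDerivAt_const (c t) (Rvdir t))

lemma slope_deriv_identity (hN : IsPlaneNorm N) (hC : ContDiffOn ℝ 2 N {0}ᶜ)
    (hc : ∀ t, fderiv ℝ N (vdir t + c t • Rvdir t) (Rvdir t) = 0)
    (hcd : Differentiable ℝ c) (t : ℝ) :
    (1 + deriv c t + c t ^ 2) *
      fderiv ℝ (fderiv ℝ N) (vdir t + c t • Rvdir t) (Rvdir t) (Rvdir t) =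
        N (vdir t + c t • Rvdir t) := by
  have he0 := vdir_add_smul_Rvdir_ne_zero t (c t)
  have he : HasDerivAt (fun t => vdir t + c t • Rvdir t)
      (Rvdir t + (c t • -vdir t + deriv c t • Rvdir t)) t :=
    (hasDerivAt_vdir t).add ((hcd t).hasDerivAt.smul (hasDerivAt_Rvdir t))
  have hD : HasDerivAt (fun t => fderiv ℝ N (vdir t + c t • Rvdir t))
      (fderiv ℝ (fderiv ℝ N) (vdir t + c t • Rvdir t)
        (Rvdir t + (c t • -vdir t + deriv c t • Rvdir t))) t :=
    (differentiableAt_fderiv hC he0).hasFDerivAt.comp_hasDerivAt t he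
  have h1 := hD.clm_apply (hasDerivAt_Rvdir t)
  simp only [hc] at h1
  have h2 := h1.unique (hasDerivAt_const t (0 : ℝ))
  have hsplit : Rvdir t + (c t • -vdir t + deriv c t • Rvdir t) =
      (1 + deriv c t + c t ^ 2) • Rvdir t - c t • (vdir t + c t • Rvdir t) := by module
  have hself := fderiv_apply_self hN hC he0
  rw [map_add, map_smul, hc t, smul_zero, add_zero] at hself
  rw [hsplit, map_sub, map_smul, map_smul, fderiv_fderiv_apply_self hN hC he0, smul_zero, sub_zero,
    map_neg, hself] at h2
  rw [smul_apply, smul_eq_mul] at h2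
  linarith

lemma contDiff_slope (hN : IsPlaneNorm N) (hC : ContDiffOn ℝ 2 N {0}ᶜ)
    (hH : ∀ x w : Plane, x ≠ 0 → w ≠ 0 → fderiv ℝ N x w = 0 → fderiv ℝ (fderiv ℝ N) x w w ≠ 0)
    (hc : ∀ t, fderiv ℝ N (vdir t + c t • Rvdir t) (Rvdir t) = 0)
    (hcd : Differentiable ℝ c) : ContDiff ℝ 1 c := by
  rw [contDiff_one_iff_deriv]
  refine ⟨hcd, ?_⟩
  have he0 := fun t => vdir_add_smul_Rvdir_ne_zero t (c t)
  have hw : Continuous Rvdir := (contDiff_Rvdir (n := 0)).continuous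
  have he : Continuous fun t => vdir t + c t • Rvdir t :=
    (contDiff_vdir (n := 0)).continuous.add (hcd.continuous.smul hw)
  have hNe : Continuous fun t => N (vdir t + c t • Rvdir t) :=
    continuous_iff_continuousAt.2 fun t => ContinuousAt.comp (g := N)
      (differentiableAt_of_ne_zero hC (he0 t)).continuousAt he.continuousAt
  have hHe : Continuous fun t => fderiv ℝ (fderiv ℝ N) (vdir t + c t • Rvdir t) :=
    continuous_iff_continuousAt.2 fun t => ContinuousAt.comp (g := fderiv ℝ (fderiv ℝ N))
      (continuousAt_fderiv_fderiv hC (he0 t)) he.continuousAt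
  have hQ0 := fun t => hH _ _ (he0 t) (Rvdir_ne_zero t) (hc t)
  have hformula : deriv c = fun t => N (vdir t + c t • Rvdir t) /
      fderiv ℝ (fderiv ℝ N) (vdir t + c t • Rvdir t) (Rvdir t) (Rvdir t) - 1 - c t ^ 2 := by
    funext t
    rw [← slope_deriv_identity hN hC hc hcd t, mul_div_cancel_right₀ _ (hQ0 t)]
    ring
  rw [hformula]
  exact ((hNe.div ((hHe.clm_apply hw).clm_apply hw) hQ0).sub continuous_const).sub
    (hcd.continuous.pow 2)

lemma bddHolderOn_deriv_slope (hN : IsPlaneNorm N) (hC : ContDiffOn ℝ 2 N {0}ᶜ)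
    {δ : ℝ} (hδ0 : 0 < δ) (hδ1 : δ < 1)
    (hN_holder : ∀ K : Set Plane, K ⊆ {0}ᶜ → IsCompact K → ∃ M : ℝ, ∀ x ∈ K, ∀ y ∈ K,
      ‖iteratedFDerivWithin ℝ 2 N ({0}ᶜ : Set Plane) x -
        iteratedFDerivWithin ℝ 2 N ({0}ᶜ : Set Plane) y‖ ≤ M * ‖x - y‖ ^ δ)
    (hH : ∀ x w : Plane, x ≠ 0 → w ≠ 0 → fderiv ℝ N x w = 0 → fderiv ℝ (fderiv ℝ N) x w w ≠ 0)
    (hc : ∀ t, fderiv ℝ N (vdir t + c t • Rvdir t) (Rvdir t) = 0)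
    (hc1 : ContDiff ℝ 1 c) {a b : ℝ} (hab : a < b) :
    BddHolderOn δ (Icc a b) (deriv c) := by
  have hcd := hc1.differentiable one_ne_zero
  set e : ℝ → Plane := fun t => vdir t + c t • Rvdir t with he_def
  have he0 : ∀ t, e t ≠ 0 := fun t => vdir_add_smul_Rvdir_ne_zero t (c t)
  have he : ContDiff ℝ 1 e := contDiff_vdir.add (hc1.smul contDiff_Rvdir)
  set Q : ℝ → ℝ := fun t => fderiv ℝ (fderiv ℝ N) (e t) (Rvdir t) (Rvdir t) with hQ_def
  have hQ0 : ∀ t, Q t ≠ 0 := fun t => hH _ _ (he0 t) (Rvdir_ne_zero t) (hc t)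
  have hQ : BddHolderOn δ (Icc a b) Q := by
    have hsin := contDiff_sin.neg.bddHolderOn hδ1 a b
    have hcos := contDiff_cos.bddHolderOn hδ1 a b
    have hent := bddHolderOn_fderiv_fderiv hC hδ0 hN_holder he he0 a b
    refine (((hsin.mul (hsin.mul (hent (mk2 1 0) (mk2 1 0)))).add
      (hcos.mul (hsin.mul (hent (mk2 0 1) (mk2 1 0))))).add
      ((hsin.mul (hcos.mul (hent (mk2 1 0) (mk2 0 1)))).add
      (hcos.mul (hcos.mul (hent (mk2 0 1) (mk2 0 1)))))).congr fun t _ => ?_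
    simp only [hQ_def, Rvdir_eq, map_add, map_smul, add_apply, smul_apply, smul_eq_mul]
    ring
  have hQc : Continuous Q := by
    have hHe : Continuous fun t => fderiv ℝ (fderiv ℝ N) (e t) :=
      continuous_iff_continuousAt.2 fun t => ContinuousAt.comp (g := fderiv ℝ (fderiv ℝ N))
        (continuousAt_fderiv_fderiv hC (he0 t)) he.continuous.continuousAt
    have hw : Continuous Rvdir := (contDiff_Rvdir (n := 0)).continuous
    exact (hHe.clm_apply hw).clm_apply hw
  obtain ⟨t₀, -, ht₀⟩ := isCompact_Icc.exists_isMinOn (nonempty_Icc.2 hab.le)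
    hQc.abs.continuousOn
  have hinv := hQ.inv (abs_pos.2 (hQ0 t₀)) fun t ht => ht₀ ht
  have hNe : BddHolderOn δ (Icc a b) fun t => N (e t) :=
    (contDiff_iff_contDiffAt.2 fun t => ContDiffAt.comp t (g := N)
      ((contDiffAt_of_ne_zero hC (he0 t)).of_le one_le_two) he.contDiffAt).bddHolderOn hδ1 a b
  have hcH := hc1.bddHolderOn hδ1 a b
  refine ((hNe.mul hinv).add ((BddHolderOn.const (-1)).add (hcH.mul hcH).neg)).congr fun t _ => ?_
  have hid : _ = N (e t) := slope_deriv_identity hN hC hc hcd t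
  rw [← hid, mul_inv_cancel_right₀ (hQ0 t)]
  ring

end Slope

/-! ### Derivative of the projection family -/

lemma norm_le_abs_inner_add (x : Plane) (t : ℝ) : ‖x‖ ≤ |⟪x, vdir t⟫| + |⟪x, Rvdir t⟫| := by
  have hv : ‖vdir t‖ = 1 := mem_sphere_zero_iff_norm.1 (vdir_mem_sphere t)
  have hw : ‖Rvdir t‖ = 1 := by
    rw [← sq_eq_sq₀ (norm_nonneg _) zero_le_one, ← real_inner_self_eq_norm_sq, inner_Rvdir]
    simp only [Rvdir, mk2, WithLp.equiv_symm_apply, Matrix.cons_val_zero, Matrix.cons_val_one]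
    linear_combination sin_sq_add_cos_sq t
  conv_lhs => rw [eq_vdir_add_Rvdir x t]
  refine (norm_add_le _ _).trans_eq ?_
  rw [norm_smul, norm_smul, hv, hw, mul_one, mul_one, Real.norm_eq_abs, Real.norm_eq_abs]

lemma hasDerivAt_inner_sub_inner_mul {c : ℝ → ℝ} (hcd : Differentiable ℝ c) (x : Plane) (t : ℝ) :
    HasDerivAt (fun t => ⟪x, Rvdir t⟫ - ⟪x, vdir t⟫ * c t)
      (-(⟪x, vdir t⟫ * (1 + deriv c t) + ⟪x, Rvdir t⟫ * c t)) t := by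
  have hv : HasDerivAt (fun t => ⟪x, vdir t⟫) ⟪x, Rvdir t⟫ t := by
    simpa using (hasDerivAt_const t x).inner ℝ (hasDerivAt_vdir t)
  have hw : HasDerivAt (fun t => ⟪x, Rvdir t⟫) (-⟪x, vdir t⟫) t := by
    simpa using (hasDerivAt_const t x).inner ℝ (hasDerivAt_Rvdir t)
  refine (hw.sub (hv.mul (hcd t).hasDerivAt)).congr_deriv ?_
  ring

lemma exists_bound_deriv {c : ℝ → ℝ} {δ a b : ℝ} (hδ1 : δ < 1) (hc1 : ContDiff ℝ 1 c)
    (hc' : BddHolderOn δ (Icc a b) (deriv c)) :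
    ∃ K, 0 < K ∧
      (∀ x : Plane, ∀ t ∈ Icc a b,
        |(-(⟪x, vdir t⟫ * (1 + deriv c t) + ⟪x, Rvdir t⟫ * c t))| ≤ K * ‖x‖) ∧
      ∀ x : Plane, ∀ s ∈ Icc a b, ∀ t ∈ Icc a b,
        |(-(⟪x, vdir s⟫ * (1 + deriv c s) + ⟪x, Rvdir s⟫ * c s)) -
          (-(⟪x, vdir t⟫ * (1 + deriv c t) + ⟪x, Rvdir t⟫ * c t))| ≤
            K * ‖x‖ * |s - t| ^ δ := by
  have hsin := contDiff_sin.bddHolderOn hδ1 a b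
  have hcos := contDiff_cos.bddHolderOn hδ1 a b
  have hc := hc1.bddHolderOn hδ1 a b
  have h1 := (BddHolderOn.const 1).add hc'
  obtain ⟨K, hK, hK₁, hK₂⟩ := ((hcos.mul h1).add (hsin.mul hc).neg).neg
  obtain ⟨L, hL, hL₁, hL₂⟩ := ((hsin.mul h1).add (hcos.mul hc)).neg
  have hx : ∀ (x : Plane) (i : Fin 2), |x i| ≤ ‖x‖ := fun x i => PiLp.norm_apply_le x i
  refine ⟨K + L + 1, by positivity, fun x t ht => ?_, fun x s hs t ht => ?_⟩
  · calc _ = |x 0 * -(cos t * (1 + deriv c t) + -(sin t * c t)) +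
          x 1 * -(sin t * (1 + deriv c t) + cos t * c t)| := by
          rw [inner_vdir, inner_Rvdir]
          ring_nf
      _ ≤ ‖x‖ * K + ‖x‖ * L := by
          refine (abs_add_le _ _).trans ?_
          rw [abs_mul, abs_mul]
          gcongr
          exacts [hx x 0, hK₁ t ht, hx x 1, hL₁ t ht]
      _ ≤ _ := by linarith [norm_nonneg x]
  · calc _ = |x 0 * (-(cos s * (1 + deriv c s) + -(sin s * c s)) -
            -(cos t * (1 + deriv c t) + -(sin t * c t))) +
          x 1 * (-(sin s * (1 + deriv c s) + cos s * c s) -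
            -(sin t * (1 + deriv c t) + cos t * c t))| := by
          simp only [inner_vdir, inner_Rvdir]
          ring_nf
      _ ≤ ‖x‖ * (K * |s - t| ^ δ) + ‖x‖ * (L * |s - t| ^ δ) := by
          refine (abs_add_le _ _).trans ?_
          rw [abs_mul, abs_mul]
          gcongr
          exacts [hx x 0, hK₂ s hs t ht, hx x 1, hL₂ s hs t ht]
      _ ≤ _ := by
          have : 0 ≤ ‖x‖ * |s - t| ^ δ := by positivity
          linarith

/-- The elementary inequality behind transversality: if `β` is close to `α c`, then
`α (1 + d) + β c` is bounded away from `0`. -/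
lemma exists_transversality_constant {M k₀ c₀ : ℝ} (hM : 0 < M) (hk₀ : 0 < k₀) (hc₀ : 0 ≤ c₀) :
    ∃ C, 0 < C ∧ ∀ α β c d n : ℝ, 0 < n → n ≤ M * (|α| + |β|) → |c| ≤ c₀ →
      k₀ ≤ |1 + d + c ^ 2| → |(β - α * c) / n| ≤ C → C ≤ |(-(α * (1 + d) + β * c)) / n| := by
  refine ⟨min (1 / (2 * M)) (k₀ / (2 * M * (1 + c₀) ^ 2)), by positivity, ?_⟩
  intro α β c d n hn hnM hc hk hΦ
  set C := min (1 / (2 * M)) (k₀ / (2 * M * (1 + c₀) ^ 2)) with hC_def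
  have hC₁ : M * C ≤ 1 / 2 := by
    have := min_le_left (1 / (2 * M)) (k₀ / (2 * M * (1 + c₀) ^ 2))
    rw [← hC_def, le_div_iff₀ (by positivity)] at this
    linarith
  have hC₂ : C * (2 * M * (1 + c₀) ^ 2) ≤ k₀ := by
    have := min_le_right (1 / (2 * M)) (k₀ / (2 * M * (1 + c₀) ^ 2))
    rwa [← hC_def, le_div_iff₀ (by positivity)] at this
  have hCpos : 0 < C := by positivity
  rw [abs_div, abs_of_pos hn, div_le_iff₀ hn] at hΦ
  rw [abs_div, abs_of_pos hn, le_div_iff₀ hn, abs_neg]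
  have hβ : |β| ≤ C * n + |α| * c₀ := by
    calc |β| = |(β - α * c) + α * c| := by ring_nf
      _ ≤ |β - α * c| + |α| * |c| := by rw [← abs_mul]; exact abs_add_le _ _
      _ ≤ _ := by gcongr
  have hα : n ≤ 2 * M * (1 + c₀) * |α| := by
    have h := mul_le_mul_of_nonneg_left hβ hM.le
    have h' := mul_le_mul_of_nonneg_right hC₁ hn.le
    nlinarith
  have hlow : |α| * k₀ - C * n * c₀ ≤ |α * (1 + d) + β * c| := by
    have h1 : |α * (1 + d + c ^ 2)| ≤ |α * (1 + d) + β * c| + |(β - α * c) * c| := by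
      have : α * (1 + d + c ^ 2) = (α * (1 + d) + β * c) - (β - α * c) * c := by ring
      rw [this]
      exact abs_sub _ _
    rw [abs_mul, abs_mul (β - α * c)] at h1
    have h2 : |α| * k₀ ≤ |α| * |1 + d + c ^ 2| := by gcongr
    have h3 : |β - α * c| * |c| ≤ C * n * c₀ := by gcongr
    linarith
  have h4 : |α| * (C * (2 * M * (1 + c₀) ^ 2)) ≤ |α| * k₀ := by gcongr
  have h5 : C * (1 + c₀) * n ≤ C * (1 + c₀) * (2 * M * (1 + c₀) * |α|) := by gcongr
  linarith

/-- main technical theorem: under the standing assumptions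
(`N` of class `C^{2,δ}` away from `0`, positive curvature of the `N`-unit
circle), the projection family `Π : J × Ω → ℝ` satisfies the Peres–Schlag
conditions: (a) `C^{1,δ}`-regularity, (b) transversality, and
(c) `(1,δ)`-regularity of `Φ`. -/
theorem main_technical_theorem_regularity_and_transversality
    (N : EuclideanSpace ℝ (Fin 2) → ℝ)
    (hN_add : ∀ x y : EuclideanSpace ℝ (Fin 2), N (x + y) ≤ N x + N y)
    (hN_smul : ∀ (c : ℝ) (x : EuclideanSpace ℝ (Fin 2)), N (c • x) = |c| * N x)
    (hN_zero : ∀ x : EuclideanSpace ℝ (Fin 2), N x = 0 → x = 0)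
    -- `N` restricted to `ℝ² \ {0}` is of class `C^{2,δ}` for some `δ ∈ (0,1)`:
    (δ : ℝ) (hδ0 : 0 < δ) (hδ1 : δ < 1)
    (hN_C2 : ContDiffOn ℝ 2 N ({0}ᶜ : Set (EuclideanSpace ℝ (Fin 2))))
    (hN_holder : ∀ K : Set (EuclideanSpace ℝ (Fin 2)), K ⊆ {0}ᶜ → IsCompact K →
      ∃ M : ℝ, ∀ x ∈ K, ∀ y ∈ K,
        ‖iteratedFDerivWithin ℝ 2 N ({0}ᶜ : Set (EuclideanSpace ℝ (Fin 2))) x -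
          iteratedFDerivWithin ℝ 2 N ({0}ᶜ : Set (EuclideanSpace ℝ (Fin 2))) y‖ ≤
            M * ‖x - y‖ ^ δ)
    -- strictly positive curvature of the `N`-unit circle:
    (γ : ℝ → EuclideanSpace ℝ (Fin 2)) (L : ℝ) (hL : 0 < L)
    (hγ_C2 : ContDiff ℝ 2 γ)
    (hγ_per : ∀ t, γ (t + L) = γ t)
    (hγ_range : Set.range γ = {x : EuclideanSpace ℝ (Fin 2) | N x = 1})
    (hγ_unit : ∀ t, ‖deriv γ t‖ = 1)
    (hγ_curv : ∀ t, deriv (deriv γ) t ≠ 0)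
    -- `P v` is the closest-point projection (w.r.t. `N`) onto `H_v`:
    (P : EuclideanSpace ℝ (Fin 2) → EuclideanSpace ℝ (Fin 2) → EuclideanSpace ℝ (Fin 2))
    (hP : ∀ v ∈ sphere (0 : EuclideanSpace ℝ (Fin 2)) 1, ∀ x : EuclideanSpace ℝ (Fin 2),
      ⟪v, P v x⟫ = 0 ∧
        ∀ q : EuclideanSpace ℝ (Fin 2), ⟪v, q⟫ = 0 → N (x - P v x) ≤ N (x - q))
    -- `J = (a,b)` a bounded open interval, `Ω` a closed ball centered at `0`:
    (a b : ℝ) (hab : a < b) (r : ℝ) (hr : 0 < r)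
    :
    -- (a) `C^{1,δ}`-regularity of `Π` on compact subintervals of `J`:
    (∀ I : Set ℝ, I ⊆ Ioo a b → IsCompact I →
      ∃ CI : ℝ, 0 < CI ∧
        (∀ t ∈ I, ∀ x ∈ closedBall (0 : EuclideanSpace ℝ (Fin 2)) r,
          |deriv (fun s => scalarProj P s x) t| ≤ CI) ∧
        (∀ x ∈ closedBall (0 : EuclideanSpace ℝ (Fin 2)) r, ∀ t₁ ∈ I, ∀ t₂ ∈ I,
          |deriv (fun s => scalarProj P s x) t₁ - deriv (fun s => scalarProj P s x) t₂| ≤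
            CI * |t₁ - t₂| ^ δ)) ∧
    -- (b) transversality on `J`, and (c) `(1,δ)`-regularity of `Φ`:
    (∃ C : ℝ, 0 < C ∧
      (∀ x ∈ closedBall (0 : EuclideanSpace ℝ (Fin 2)) r,
        ∀ y ∈ closedBall (0 : EuclideanSpace ℝ (Fin 2)) r, x ≠ y →
          ∀ t ∈ Ioo a b, |projQuot N P t x y| ≤ C →
            C ≤ |deriv (fun s => projQuot N P s x y) t|) ∧
      (∃ Ct : ℝ, 0 < Ct ∧ ∃ Cδ : ℝ, 0 < Cδ ∧
        ∀ x ∈ closedBall (0 : EuclideanSpace ℝ (Fin 2)) r,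
          ∀ y ∈ closedBall (0 : EuclideanSpace ℝ (Fin 2)) r, x ≠ y →
            ∀ t₁ ∈ Ioo a b, ∀ t₂ ∈ Ioo a b,
              |projQuot N P t₁ x y| + |projQuot N P t₂ x y| ≤ C →
                |deriv (fun s => projQuot N P s x y) t₁| ≤ Ct ∧
                |deriv (fun s => projQuot N P s x y) t₁ -
                    deriv (fun s => projQuot N P s x y) t₂| ≤ Cδ * |t₁ - t₂| ^ δ)) := by
  have hN : IsPlaneNorm N := ⟨hN_add, hN_smul, hN_zero⟩
  have hH : ∀ x w : Plane, x ≠ 0 → w ≠ 0 → fderiv ℝ N x w = 0 →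
      fderiv ℝ (fderiv ℝ N) x w w ≠ 0 := fun x w =>
    fderiv_fderiv_apply_ne_zero hN hN_C2 hγ_C2 hγ_range hγ_unit hγ_curv
  obtain ⟨c, hc, huniq, hproj⟩ := exists_slope hN hN_C2 hH hP
  have hcd := differentiable_slope hN_C2 hH hc huniq
  have hc1 := contDiff_slope hN hN_C2 hH hc hcd
  have hc' := bddHolderOn_deriv_slope hN hN_C2 hδ0 hδ1 hN_holder hH hc hc1 hab
  obtain ⟨K, hK, hK₁, hK₂⟩ := exists_bound_deriv hδ1 hc1 hc'
  constructor
  · intro I hI _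
    have hIcc : I ⊆ Icc a b := hI.trans Ioo_subset_Icc_self
    have hderiv : ∀ x t, deriv (fun s => scalarProj P s x) t =
        -(⟪x, vdir t⟫ * (1 + deriv c t) + ⟪x, Rvdir t⟫ * c t) := fun x t => by
      simp only [hproj]
      exact (hasDerivAt_inner_sub_inner_mul hcd x t).deriv
    refine ⟨K * r, by positivity, fun t ht x hx => ?_, fun x hx t₁ ht₁ t₂ ht₂ => ?_⟩
    · rw [mem_closedBall_zero_iff] at hx
      rw [hderiv]
      refine (hK₁ x t (hIcc ht)).trans ?_
      gcongr
    · rw [mem_closedBall_zero_iff] at hx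
      rw [hderiv, hderiv]
      refine (hK₂ x t₁ (hIcc ht₁) t₂ (hIcc ht₂)).trans ?_
      gcongr
  · have hquot : ∀ t x y, projQuot N P t x y =
        (⟪x - y, Rvdir t⟫ - ⟪x - y, vdir t⟫ * c t) / N (x - y) := fun t x y => by
      rw [projQuot, hproj, hproj, inner_sub_left, inner_sub_left]
      ring
    have hderiv : ∀ x y t, deriv (fun s => projQuot N P s x y) t =
        -(⟪x - y, vdir t⟫ * (1 + deriv c t) + ⟪x - y, Rvdir t⟫ * c t) / N (x - y) :=
      fun x y t => by
        simp only [hquot]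
        exact ((hasDerivAt_inner_sub_inner_mul hcd (x - y) t).div_const _).deriv
    obtain ⟨M, hM, hM'⟩ := hN.exists_le_norm
    obtain ⟨M₁, hM₁, hM₁'⟩ := hN.exists_norm_le hN_C2.continuousOn
    obtain ⟨c₀, hc₀, hc₀', -⟩ := hc1.bddHolderOn hδ1 a b
    have hk : Continuous fun t => 1 + deriv c t + c t ^ 2 :=
      (continuous_const.add (hc1.continuous_deriv le_rfl)).add (hc1.continuous.pow 2)
    obtain ⟨t₀, -, ht₀⟩ := isCompact_Icc.exists_isMinOn (nonempty_Icc.2 hab.le)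
      hk.abs.continuousOn
    have hk₀ : 0 < |1 + deriv c t₀ + c t₀ ^ 2| := abs_pos.2 fun h => by
      have hid := slope_deriv_identity hN hN_C2 hc hcd t₀
      rw [h, zero_mul] at hid
      exact (hN.pos (vdir_add_smul_Rvdir_ne_zero t₀ (c t₀))).ne hid
    obtain ⟨C, hC, hC'⟩ := exists_transversality_constant hM hk₀ hc₀
    refine ⟨C, hC, ?_, K * M₁, by positivity, K * M₁, by positivity, ?_⟩
    · intro x _ y _ hxy t ht hΦ
      have ht' := Ioo_subset_Icc_self ht
      rw [hquot] at hΦ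
      rw [hderiv]
      refine hC' _ _ _ _ _ (hN.pos (sub_ne_zero.2 hxy)) ((hM' _).trans ?_) (hc₀' t ht')
        (ht₀ ht') hΦ
      gcongr
      exact norm_le_abs_inner_add _ t
    · intro x _ y _ hxy t₁ ht₁ t₂ ht₂ _
      have ht₁' := Ioo_subset_Icc_self ht₁
      have ht₂' := Ioo_subset_Icc_self ht₂
      have hpos := hN.pos (sub_ne_zero.2 hxy)
      have hKM : K * ‖x - y‖ ≤ K * M₁ * N (x - y) := by
        rw [mul_assoc]
        gcongr
        exact hM₁' _
      rw [hderiv, hderiv, ← sub_div, abs_div, abs_div, abs_of_pos hpos, div_le_iff₀ hpos,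
        div_le_iff₀ hpos]
      refine ⟨(hK₁ _ t₁ ht₁').trans hKM, (hK₂ _ t₁ ht₁' t₂ ht₂').trans ?_⟩
      rw [mul_right_comm (K * M₁)]
      exact mul_le_mul_of_nonneg_right hKM (by positivity)
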